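/- arXiv:2506.16708 — 2 statements merged into one kernel-verified Lean document; each statement's English description precedes it below -/
import Mathlib

section
/- Let n ≥ 1 and let F, G : GL_n(ℝ) → ℂ be continuous O(n)-bi-invariant functions such that all integrals below converge absolutely for every h ∈ GL_n(ℝ). Let S₁, S₂ ⊆ {1,…,n}. Then for every h ∈ GL_n(ℝ): ∫_{GL_n(ℝ)} Δ_{S₁}(g) F(g) Δ_{S₂}(g⁻¹h) G(g⁻¹h) dμ(g) = ([S₁ = S₂] / binom(n,|S₁|)) · Δ_{S₁}(h) · ∫_{GL_n(ℝ)} F(g) G(g⁻¹h) dμ(g), where [S₁ = S₂] equals 1 if S₁ = S₂ and 0 otherwise. In particular, the functions of the form g ↦ Δ_S(g)F(g) with F an O(n)-bi-invariant function span a commutative algebra under convolution with respect to dμ. -/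
open MeasureTheory

/-- Lebesgue measure on the space of real `n × n` matrices (product measure over the
`n²` matrix entries). -/
noncomputable instance matrixMeasureSpace (n : ℕ) :
    MeasureSpace (Matrix (Fin n) (Fin n) ℝ) :=
  inferInstanceAs (MeasureSpace (Fin n → Fin n → ℝ))

/-- The (two-sided) Haar measure `dμ(g) = |det g|^{-n} dg` on `GL_n(ℝ)`, viewed as a
measure on `Mat_n(ℝ)` (the complement of `GL_n(ℝ)` has density `0`). -/
noncomputable def haarGL (n : ℕ) : Measure (Matrix (Fin n) (Fin n) ℝ) :=
  volume.withDensity fun g => ENNReal.ofReal ((|g.det| ^ n)⁻¹)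

/-- The principal minor `Δ_S(g)` of `g` on rows and columns `S` (`Δ_∅(g) = 1`). -/
noncomputable def principalMinor {n : ℕ} (g : Matrix (Fin n) (Fin n) ℝ)
    (S : Finset (Fin n)) : ℝ :=
  Matrix.det (Matrix.of fun i j : S => g i j)


section Combinatorics

lemma det_mul_eq_sum_fun {m N : Type*} [Fintype m] [DecidableEq m] [Fintype N] [DecidableEq N]
    (A : Matrix m N ℝ) (B : Matrix N m ℝ) :
    (A * B).det = ∑ f : m → N, (A.submatrix id f).det * ∏ i, B (f i) i := by
  rw [← Matrix.det_transpose]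
  have h1 : (A * B).transpose = fun j => ∑ l, B l j • A.transpose l := by
    ext j i
    simp [Matrix.mul_apply, mul_comm]
  have h2 := (Matrix.detRowAlternating (n := m) (R := ℝ)).toMultilinearMap.map_sum
    (fun (j : m) (l : N) => B l j • A.transpose l)
  have h3 : (A * B).transpose.det = Matrix.detRowAlternating (n := m) (R := ℝ)
      (fun j => ∑ l, B l j • A.transpose l) := by rw [h1]; rfl
  rw [h3]
  refine h2.trans (Finset.sum_congr rfl fun f _ => ?_)
  rw [MultilinearMap.map_smul_univ, smul_eq_mul, mul_comm]
  congr 1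
  rw [← Matrix.det_transpose]
  rfl

lemma sum_det_mul_det {m N : Type*} [Fintype m] [DecidableEq m] [Fintype N] [DecidableEq N]
    (A : Matrix m N ℝ) (B : Matrix N m ℝ) :
    ∑ f : m → N, (A.submatrix id f).det * (B.submatrix f id).det
      = ((Fintype.card m).factorial : ℝ) * (A * B).det := by
  have h : ∀ τ : Equiv.Perm m, ∑ f : m → N, (A.submatrix id f).det *
      (((Equiv.Perm.sign τ : ℤ) : ℝ) * ∏ i, B (f (τ i)) i) = (A * B).det := by
    intro τ
    rw [det_mul_eq_sum_fun]
    rw [← Equiv.sum_comp (Equiv.arrowCongr τ.symm (Equiv.refl N))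
      (fun f => (A.submatrix id f).det * ∏ i, B (f i) i)]
    refine Finset.sum_congr rfl fun f _ => ?_
    have : A.submatrix id ((Equiv.arrowCongr τ.symm (Equiv.refl N)) f)
        = (A.submatrix id f).submatrix id τ := by
      ext i j; simp [Equiv.arrowCongr]
    rw [this, Matrix.det_permute']
    simp [Equiv.arrowCongr]
    ring
  calc _ = ∑ f : m → N, ∑ τ : Equiv.Perm m, (A.submatrix id f).det *
      (((Equiv.Perm.sign τ : ℤ) : ℝ) * ∏ i, B (f (τ i)) i) := by
        refine Finset.sum_congr rfl fun f _ => ?_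
        rw [Matrix.det_apply' (B.submatrix f id), Finset.mul_sum]
        rfl
    _ = _ := by
        rw [Finset.sum_comm, Finset.sum_congr rfl fun τ _ => h τ]
        simp [Fintype.card_perm]

lemma exists_perm_extend {N : Type*} [Fintype N] [DecidableEq N] (S : Finset N) (f : S ↪ N) :
    ∃ ρ : Equiv.Perm N, ∀ i : S, ρ i = f i := by
  classical
  let e : {x // x ∈ S} ≃ {x // x ∈ Set.range f} := Equiv.ofInjective f f.injective
  refine ⟨e.extendSubtype, fun i => ?_⟩
  rw [Equiv.extendSubtype_apply_of_mem e i i.2]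
  rfl

lemma sum_perm_restrict {N : Type*} [Fintype N] [DecidableEq N] (S : Finset N)
    (φ : (S → N) → ℝ) (hφ : ∀ f, ¬ Function.Injective f → φ f = 0) :
    ((Fintype.card N).descFactorial S.card : ℝ) * ∑ σ : Equiv.Perm N, φ (fun i => σ i)
      = ((Fintype.card N).factorial : ℝ) * ∑ f : S → N, φ f := by
  have h1 : ∀ f : S ↪ N, ∑ τ : Equiv.Perm N, φ (fun i => τ (f i))
      = ∑ τ : Equiv.Perm N, φ (fun i => τ i) := by
    intro f
    obtain ⟨ρ, hρ⟩ := exists_perm_extend S f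
    rw [← Equiv.sum_comp (Equiv.mulRight ρ) (fun τ : Equiv.Perm N => φ (fun i => τ i))]
    refine Finset.sum_congr rfl fun τ _ => ?_
    congr 1
    ext i
    simp [hρ]
  have h0 : ∑ f : S → N, φ f = ∑ f : S ↪ N, φ f := by
    symm
    refine Finset.sum_of_injOn (fun f : S ↪ N => (f : S → N)) ?_ ?_ ?_ ?_
    · intro a _ b _ h; exact DFunLike.coe_injective h
    · intro a _; simp
    · intro f _ hf
      apply hφ
      intro hinj
      exact hf ⟨⟨f, hinj⟩, by simp, rfl⟩
    · intro a _; rfl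
  have h2 : ∀ τ : Equiv.Perm N, ∑ f : S → N, φ (fun i => τ (f i)) = ∑ f : S → N, φ f := by
    intro τ
    exact Equiv.sum_comp (Equiv.arrowCongr (Equiv.refl S) τ) φ
  have h3 : ∀ τ : Equiv.Perm N, ∑ f : S ↪ N, φ (fun i => τ (f i)) = ∑ f : S ↪ N, φ f := by
    intro τ
    refine Fintype.sum_equiv (Equiv.embeddingCongr (Equiv.refl S) τ) _ _ fun f => ?_
    congr 1
  have hc : ((Fintype.card N).descFactorial S.card : ℝ) = (Fintype.card (S ↪ N) : ℝ) := by
    rw [Fintype.card_embedding_eq]; simp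
  rw [hc, h0]
  calc _ = ∑ f : S ↪ N, ∑ τ : Equiv.Perm N, φ (fun i => τ (f i)) := by
        rw [Finset.sum_congr rfl fun f _ => h1 f]; simp
    _ = _ := by
        rw [Finset.sum_comm, Finset.sum_congr rfl fun f _ => h3 f]; simp [Fintype.card_perm]

lemma sum_perm_det {n : ℕ} (S : Finset (Fin n)) (A : Matrix S (Fin n) ℝ)
    (B : Matrix (Fin n) S ℝ) :
    (n.choose S.card : ℝ) * ∑ σ : Equiv.Perm (Fin n),
      (A.submatrix id (fun i : S => σ i)).det * (B.submatrix (fun i : S => σ i) id).det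
      = (n.factorial : ℝ) * (A * B).det := by
  have h := sum_perm_restrict S
    (fun f => (A.submatrix id f).det * (B.submatrix f id).det) (by
      intro f hf
      simp only [Function.Injective, not_forall] at hf
      obtain ⟨a, b, hab, hne⟩ := hf
      rw [Matrix.det_zero_of_column_eq hne (by intro k; simp [hab]), zero_mul])
  simp only [sum_det_mul_det, Fintype.card_fin, Fintype.card_coe,
    Nat.descFactorial_eq_factorial_mul_choose] at h
  have hp : (S.card.factorial : ℝ) ≠ 0 := by positivity
  apply mul_left_cancel₀ hp
  push_cast at h
  linear_combination h

lemma sum_signs {n : ℕ} (S T : Finset (Fin n)) :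
    ∑ ε : Fin n → ℤˣ, (∏ i ∈ S, ((ε i : ℤ) : ℝ)) * (∏ i ∈ T, ((ε i : ℤ) : ℝ))
      = if S = T then (2 : ℝ) ^ n else 0 := by
  split_ifs with hST
  · subst hST
    have : ∀ ε : Fin n → ℤˣ, (∏ i ∈ S, ((ε i : ℤ) : ℝ)) * (∏ i ∈ S, ((ε i : ℤ) : ℝ)) = 1 := by
      intro ε
      rw [← Finset.prod_mul_distrib]
      refine Finset.prod_eq_one fun i _ => ?_
      rcases Int.units_eq_one_or (ε i) with h | h <;> simp [h]
    simp [this]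
  · have hj : ∃ j, ¬ (j ∈ S ↔ j ∈ T) := by
      by_contra hcon
      push Not at hcon
      exact hST (Finset.ext hcon)
    obtain ⟨j, hj⟩ := hj
    have key : ∀ (U : Finset (Fin n)) (ε : Fin n → ℤˣ),
        ∏ i ∈ U, ((((Pi.mulSingle j (-1) * ε : Fin n → ℤˣ) i : ℤˣ) : ℤ) : ℝ)
          = (if j ∈ U then -1 else 1) * ∏ i ∈ U, ((ε i : ℤ) : ℝ) := by
      intro U ε
      simp only [Pi.mul_apply, Units.val_mul, Int.cast_mul, Finset.prod_mul_distrib]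
      congr 1
      have : ∀ i, (((Pi.mulSingle j (-1 : ℤˣ) : Fin n → ℤˣ) i : ℤ) : ℝ)
          = if i = j then -1 else 1 := by
        intro i
        by_cases h : i = j
        · subst h; simp
        · simp [h]
      simp [this, Finset.prod_ite_eq']
    have h := Equiv.sum_comp (Equiv.mulLeft (Pi.mulSingle j (-1) : Fin n → ℤˣ))
      (fun ε : Fin n → ℤˣ => (∏ i ∈ S, ((ε i : ℤ) : ℝ)) * (∏ i ∈ T, ((ε i : ℤ) : ℝ)))
    simp only [Equiv.coe_mulLeft, key] at h
    have h' : ∀ ε : Fin n → ℤˣ, ((if j ∈ S then -1 else 1) * ∏ i ∈ S, ((ε i : ℤ) : ℝ)) *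
        ((if j ∈ T then -1 else 1) * ∏ i ∈ T, ((ε i : ℤ) : ℝ))
        = - ((∏ i ∈ S, ((ε i : ℤ) : ℝ)) * (∏ i ∈ T, ((ε i : ℤ) : ℝ))) := by
      intro ε
      by_cases h1 : j ∈ S <;> by_cases h2 : j ∈ T <;> simp_all
    simp only [h', Finset.sum_neg_distrib] at h
    linarith

/-- Signed permutation matrix. -/
def signedPerm {n : ℕ} (σ : Equiv.Perm (Fin n)) (ε : Fin n → ℤˣ) : Matrix (Fin n) (Fin n) ℝ :=
  Matrix.of fun a j => if a = σ j then ((ε j : ℤ) : ℝ) else 0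

lemma mul_signedPerm {n : ℕ} (σ : Equiv.Perm (Fin n)) (ε : Fin n → ℤˣ)
    (g : Matrix (Fin n) (Fin n) ℝ) (i j : Fin n) :
    (g * signedPerm σ ε) i j = ((ε j : ℤ) : ℝ) * g i (σ j) := by
  simp [Matrix.mul_apply, signedPerm, mul_comm]

lemma signedPerm_transpose_mul {n : ℕ} (σ : Equiv.Perm (Fin n)) (ε : Fin n → ℤˣ)
    (g : Matrix (Fin n) (Fin n) ℝ) (i j : Fin n) :
    ((signedPerm σ ε).transpose * g) i j = ((ε i : ℤ) : ℝ) * g (σ i) j := by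
  simp [Matrix.mul_apply, signedPerm]

lemma signedPerm_mem {n : ℕ} (σ : Equiv.Perm (Fin n)) (ε : Fin n → ℤˣ) :
    signedPerm σ ε ∈ Matrix.orthogonalGroup (Fin n) ℝ := by
  rw [Matrix.mem_orthogonalGroup_iff']
  change (signedPerm σ ε).transpose * signedPerm σ ε = 1
  ext i j
  rw [signedPerm_transpose_mul]
  by_cases h : i = j
  · subst h
    rcases Int.units_eq_one_or (ε i) with h | h <;> simp [signedPerm, h]
  · simp [signedPerm, h]

lemma principalMinor_mul_signedPerm {n : ℕ} (σ : Equiv.Perm (Fin n)) (ε : Fin n → ℤˣ)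
    (g : Matrix (Fin n) (Fin n) ℝ) (S : Finset (Fin n)) :
    principalMinor (g * signedPerm σ ε) S = (∏ i ∈ S, ((ε i : ℤ) : ℝ)) *
      ((g.submatrix (fun i : S => (i : Fin n)) id).submatrix id (fun i : S => σ i)).det := by
  rw [principalMinor, ← Finset.prod_coe_sort S (fun i => ((ε i : ℤ) : ℝ)),
    ← Matrix.det_mul_row]
  congr 1
  ext i j
  simp [mul_signedPerm]

lemma principalMinor_signedPerm_mul {n : ℕ} (σ : Equiv.Perm (Fin n)) (ε : Fin n → ℤˣ)
    (g : Matrix (Fin n) (Fin n) ℝ) (S : Finset (Fin n)) :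
    principalMinor ((signedPerm σ ε).transpose * g) S = (∏ i ∈ S, ((ε i : ℤ) : ℝ)) *
      ((g.submatrix id (fun i : S => (i : Fin n))).submatrix (fun i : S => σ i) id).det := by
  rw [principalMinor, ← Finset.prod_coe_sort S (fun i => ((ε i : ℤ) : ℝ)),
    ← Matrix.det_mul_column]
  congr 1
  ext i j
  simp [signedPerm_transpose_mul]

lemma average_minors {n : ℕ} (g x : Matrix (Fin n) (Fin n) ℝ) (S T : Finset (Fin n)) :
    (n.choose S.card : ℝ) * ∑ p : Equiv.Perm (Fin n) × (Fin n → ℤˣ),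
      principalMinor (g * signedPerm p.1 p.2) S *
        principalMinor ((signedPerm p.1 p.2).transpose * x) T
      = (if S = T then (2 : ℝ) ^ n else 0) * ((n.factorial : ℝ) * principalMinor (g * x) S) := by
  rw [← sum_signs, Fintype.sum_prod_type]
  simp only [principalMinor_mul_signedPerm, principalMinor_signedPerm_mul]
  by_cases hST : S = T
  · subst hST
    have h := sum_perm_det S (g.submatrix (fun i : S => (i : Fin n)) id)
      (x.submatrix id (fun i : S => (i : Fin n)))
    have h' : principalMinor (g * x) S = ((g.submatrix (fun i : S => (i : Fin n)) id) *
      (x.submatrix id (fun i : S => (i : Fin n)))).det := by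
      rw [principalMinor]; congr 1
    rw [h', ← h, mul_left_comm]
    congr 1
    rw [Finset.sum_mul_sum, Finset.sum_comm]
    refine Finset.sum_congr rfl fun σ _ => Finset.sum_congr rfl fun ε _ => by ring
  · have hz := sum_signs S T
    rw [if_neg hST] at hz
    rw [hz, zero_mul]
    convert mul_zero _
    refine Finset.sum_eq_zero fun σ _ => ?_
    rw [Finset.sum_congr rfl fun ε _ => mul_mul_mul_comm _ _ _ _, ← Finset.sum_mul, hz, zero_mul]

end Combinatorics

section Polar
open scoped MatrixOrder Matrix.Norms.L2Operator

lemma exists_orthogonal_transpose {n : ℕ} (h : Matrix (Fin n) (Fin n) ℝ) (hh : IsUnit h.det) :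
    ∃ u ∈ Matrix.orthogonalGroup (Fin n) ℝ, h.transpose = u * h * u := by
  have hstar : ∀ A : Matrix (Fin n) (Fin n) ℝ, star A = A.transpose := by
    intro A; ext a b; simp [Matrix.star_apply]
  obtain ⟨P, hPs, hPP⟩ : ∃ P : Matrix (Fin n) (Fin n) ℝ, P.transpose = P ∧
      P * P = h.transpose * h := by
    have h0 : 0 ≤ star h * h := star_mul_self_nonneg h
    refine ⟨CFC.sqrt (star h * h), ?_, ?_⟩
    · rw [← hstar]
      exact (CFC.sqrt_nonneg (star h * h)).isSelfAdjoint
    · rw [CFC.sqrt_mul_sqrt_self _ h0, hstar]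
  have hPdet : IsUnit P.det := by
    have := congrArg Matrix.det hPP
    rw [Matrix.det_mul, Matrix.det_mul, Matrix.det_transpose] at this
    rw [isUnit_iff_ne_zero] at hh ⊢
    intro h0
    rw [h0] at this
    simp at this
    exact hh this
  -- h = w * P
  set w := h * P⁻¹ with hw
  have hwP : w * P = h := by rw [hw, Matrix.nonsing_inv_mul_cancel_right _ _ hPdet]
  have hww : w.transpose * w = 1 := by
    rw [hw, Matrix.transpose_mul, Matrix.transpose_nonsing_inv, hPs]
    calc P⁻¹ * h.transpose * (h * P⁻¹) = P⁻¹ * (h.transpose * h) * P⁻¹ := by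
          simp only [Matrix.mul_assoc]
      _ = 1 := by
          rw [← hPP, ← Matrix.mul_assoc, Matrix.nonsing_inv_mul _ hPdet, Matrix.one_mul,
            Matrix.mul_nonsing_inv _ hPdet]
  have hww' : w * w.transpose = 1 := mul_eq_one_comm.mp hww
  refine ⟨w.transpose, ?_, ?_⟩
  · rw [Matrix.mem_orthogonalGroup_iff, Matrix.transpose_transpose, hww]
  · rw [← hwP, Matrix.transpose_mul, hPs, ← Matrix.mul_assoc, hww, Matrix.one_mul]
end Polar

section ChangeVar

lemma det_linear_mul_right {n : ℕ} (B : Matrix (Fin n) (Fin n) ℝ) :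
    LinearMap.det (LinearMap.mulRight ℝ B) = B.det ^ n := by
  have h : LinearMap.mulRight ℝ B = LinearMap.pi (fun i => (Matrix.vecMulLinear B) ∘ₗ
      (LinearMap.proj i : (Fin n → Fin n → ℝ) →ₗ[ℝ] (Fin n → ℝ))) := by
    ext X i j
    rfl
  have h2 : LinearMap.det (Matrix.vecMulLinear B) = B.det := by
    rw [← Matrix.det_transpose, ← LinearMap.det_toLin']
    congr 1
    ext v j
    simp
  have := LinearMap.det_pi (R := ℝ) (fun _ : Fin n => Matrix.vecMulLinear B)
  rw [Finset.prod_const, h2, Finset.card_univ, Fintype.card_fin] at this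
  rw [← this, h]
  rfl

lemma det_linear_mul_left {n : ℕ} (A : Matrix (Fin n) (Fin n) ℝ) :
    LinearMap.det (LinearMap.mulLeft ℝ A) = A.det ^ n := by
  rw [← Matrix.det_transpose, ← det_linear_mul_right, ← LinearMap.det_conj
    (LinearMap.mulRight ℝ A.transpose) (Matrix.transposeLinearEquiv (Fin n) (Fin n) ℝ ℝ)]
  congr 1
  refine LinearMap.ext fun X => ?_
  change A * X = (X.transpose * A.transpose).transpose
  rw [Matrix.transpose_mul, Matrix.transpose_transpose, Matrix.transpose_transpose]

lemma det_transposeL {n : ℕ} :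
    |LinearMap.det ((Matrix.transposeLinearEquiv (Fin n) (Fin n) ℝ ℝ).toLinearMap)| = 1 := by
  have h : (Matrix.transposeLinearEquiv (Fin n) (Fin n) ℝ ℝ).toLinearMap ∘ₗ
      (Matrix.transposeLinearEquiv (Fin n) (Fin n) ℝ ℝ).toLinearMap = LinearMap.id := by
    ext X i j; simp
  have := congrArg LinearMap.det h
  rw [LinearMap.det_comp, LinearMap.det_id] at this
  rcases mul_self_eq_one_iff.mp this with h | h <;> simp [h]

instance borelMat (n : ℕ) : BorelSpace (Matrix (Fin n) (Fin n) ℝ) :=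
  inferInstanceAs (BorelSpace (Fin n → Fin n → ℝ))

lemma measurable_dens (n : ℕ) :
    Measurable fun g : Matrix (Fin n) (Fin n) ℝ => (|g.det| ^ n)⁻¹.toNNReal := by
  have : Measurable fun g : Matrix (Fin n) (Fin n) ℝ => g.det :=
    (Continuous.matrix_det continuous_id).measurable
  fun_prop

lemma isOpen_GL (n : ℕ) : IsOpen {g : Matrix (Fin n) (Fin n) ℝ | g.det ≠ 0} :=
  isOpen_ne_fun (Continuous.matrix_det continuous_id) continuous_const

lemma change_var {n : ℕ} (hn : 1 ≤ n)
    (φ : Matrix (Fin n) (Fin n) ℝ → Matrix (Fin n) (Fin n) ℝ)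
    (φ' : Matrix (Fin n) (Fin n) ℝ → Matrix (Fin n) (Fin n) ℝ →L[ℝ] Matrix (Fin n) (Fin n) ℝ)
    (hd : ∀ g, g.det ≠ 0 → HasFDerivAt φ (φ' g) g)
    (hinj : Set.InjOn φ {g | g.det ≠ 0})
    (himg : φ '' {g | g.det ≠ 0} = {g | g.det ≠ 0})
    (hJ : ∀ g, g.det ≠ 0 → |(φ' g).det| * (|(φ g).det| ^ n)⁻¹ = (|g.det| ^ n)⁻¹)
    (f : Matrix (Fin n) (Fin n) ℝ → ℂ) :
    (∫ g, f (φ g) ∂(haarGL n) = ∫ g, f g ∂(haarGL n)) ∧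
    (Integrable f (haarGL n) → Integrable (fun g => f (φ g)) (haarGL n)) := by
  set s := {g : Matrix (Fin n) (Fin n) ℝ | g.det ≠ 0} with hs
  have hms : MeasurableSet s := (isOpen_GL n).measurableSet
  have hhaar : haarGL n = volume.withDensity
    (fun g => (((|g.det| ^ n)⁻¹.toNNReal : NNReal) : ENNReal)) := rfl
  have hsm : ∀ (g : Matrix (Fin n) (Fin n) ℝ) (z : ℂ),
      (|g.det| ^ n)⁻¹.toNNReal • z = (|g.det| ^ n)⁻¹ • z := by
    intro g z
    rw [NNReal.smul_def, Real.coe_toNNReal _ (by positivity)]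
  have hsupp : ∀ f : Matrix (Fin n) (Fin n) ℝ → ℂ,
      Function.support (fun g => (|g.det| ^ n)⁻¹ • f g) ⊆ s := by
    intro f g hg
    simp only [Function.mem_support] at hg
    intro h0
    apply hg
    rw [h0, abs_zero, zero_pow (by omega), inv_zero, zero_smul]
  have hI : ∀ f : Matrix (Fin n) (Fin n) ℝ → ℂ, ∫ g, f g ∂(haarGL n)
      = ∫ g in s, (|g.det| ^ n)⁻¹ • f g := by
    intro f
    rw [hhaar, integral_withDensity_eq_integral_smul (measurable_dens n)]
    simp only [hsm]
    rw [setIntegral_eq_integral_of_forall_compl_eq_zero]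
    intro x hx
    by_contra h
    exact hx (hsupp f h)
  have hInt : ∀ f : Matrix (Fin n) (Fin n) ℝ → ℂ, Integrable f (haarGL n) ↔
      IntegrableOn (fun g => (|g.det| ^ n)⁻¹ • f g) s := by
    intro f
    rw [hhaar, integrable_withDensity_iff_integrable_smul (measurable_dens n)]
    simp only [hsm]
    rw [integrableOn_iff_integrable_of_support_subset (hsupp f)]
  have hcong : ∀ g ∈ s, |(φ' g).det| • ((|(φ g).det| ^ n)⁻¹ • f (φ g))
      = (|g.det| ^ n)⁻¹ • f (φ g) := by
    intro g hg
    rw [smul_smul, hJ g hg]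
  have hd' : ∀ x ∈ s, HasFDerivWithinAt φ (φ' x) s x := fun x hx => (hd x hx).hasFDerivWithinAt
  constructor
  · rw [hI, hI]
    have : ∫ g in φ '' s, (|g.det| ^ n)⁻¹ • f g
        = ∫ g in s, |(φ' g).det| • ((|(φ g).det| ^ n)⁻¹ • f (φ g)) :=
      integral_image_eq_integral_abs_det_fderiv_smul (E := Fin n → Fin n → ℝ) volume hms hd' hinj
        (fun g : Matrix (Fin n) (Fin n) ℝ => (|g.det| ^ n)⁻¹ • f g)
    rw [himg] at this
    rw [this]
    exact setIntegral_congr_fun hms fun g hg => (hcong g hg).symm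
  · rw [hInt, hInt]
    intro h
    have : IntegrableOn (fun g => (|g.det| ^ n)⁻¹ • f g) (φ '' s) ↔
        IntegrableOn (fun g => |(φ' g).det| • ((|(φ g).det| ^ n)⁻¹ • f (φ g))) s :=
      integrableOn_image_iff_integrableOn_abs_det_fderiv_smul (E := Fin n → Fin n → ℝ) volume
        hms hd' hinj (fun g : Matrix (Fin n) (Fin n) ℝ => (|g.det| ^ n)⁻¹ • f g)
    rw [himg] at this
    exact (this.mp h).congr_fun hcong hms

/-- A generic involutive-type criterion for the image. -/
lemma image_of_inverse {n : ℕ} (φ ψ : Matrix (Fin n) (Fin n) ℝ → Matrix (Fin n) (Fin n) ℝ)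
    (h1 : ∀ g, g.det ≠ 0 → (φ g).det ≠ 0) (h2 : ∀ g, g.det ≠ 0 → (ψ g).det ≠ 0)
    (h3 : ∀ g, g.det ≠ 0 → φ (ψ g) = g) :
    φ '' {g | g.det ≠ 0} = {g | g.det ≠ 0} := by
  ext g
  constructor
  · rintro ⟨x, hx, rfl⟩; exact h1 x hx
  · intro hg; exact ⟨ψ g, h2 g hg, h3 g hg⟩

lemma cv_right {n : ℕ} (hn : 1 ≤ n) (k : Matrix (Fin n) (Fin n) ℝ) (hk : IsUnit k.det)
    (f : Matrix (Fin n) (Fin n) ℝ → ℂ) :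
    (∫ g, f (g * k) ∂(haarGL n) = ∫ g, f g ∂(haarGL n)) ∧
    (Integrable f (haarGL n) → Integrable (fun g => f (g * k)) (haarGL n)) := by
  have hk0 := hk.ne_zero
  refine change_var hn (fun g => g * k)
    (fun _ => LinearMap.toContinuousLinearMap (LinearMap.mulRight ℝ k)) ?_ ?_ ?_ ?_ f
  · intro g _
    exact (LinearMap.toContinuousLinearMap (LinearMap.mulRight ℝ k)).hasFDerivAt
  · intro a _ b _ hab
    exact (Matrix.isUnit_iff_isUnit_det k |>.mpr hk).mul_left_injective hab
  · refine image_of_inverse _ (fun g => g * k⁻¹) ?_ ?_ ?_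
    · intro g hg; simp [hg, hk0]
    · intro g hg; simp [hg, hk0]
    · intro g _; exact Matrix.nonsing_inv_mul_cancel_right _ _ hk
  · intro g hg
    rw [LinearMap.det_toContinuousLinearMap, det_linear_mul_right]
    simp only [Matrix.det_mul, abs_mul, abs_pow, mul_pow, mul_inv]
    have : |k.det| ^ n ≠ 0 := by positivity
    field_simp

lemma cv_left {n : ℕ} (hn : 1 ≤ n) (k : Matrix (Fin n) (Fin n) ℝ) (hk : IsUnit k.det)
    (f : Matrix (Fin n) (Fin n) ℝ → ℂ) :
    (∫ g, f (k * g) ∂(haarGL n) = ∫ g, f g ∂(haarGL n)) ∧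
    (Integrable f (haarGL n) → Integrable (fun g => f (k * g)) (haarGL n)) := by
  have hk0 := hk.ne_zero
  refine change_var hn (fun g => k * g)
    (fun _ => LinearMap.toContinuousLinearMap (LinearMap.mulLeft ℝ k)) ?_ ?_ ?_ ?_ f
  · intro g _
    exact (LinearMap.toContinuousLinearMap (LinearMap.mulLeft ℝ k)).hasFDerivAt
  · intro a _ b _ hab
    exact (Matrix.isUnit_iff_isUnit_det k |>.mpr hk).mul_right_injective hab
  · refine image_of_inverse _ (fun g => k⁻¹ * g) ?_ ?_ ?_
    · intro g hg; simp [hg, hk0]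
    · intro g hg; simp [hg, hk0]
    · intro g _; exact Matrix.mul_nonsing_inv_cancel_left _ _ hk
  · intro g hg
    rw [LinearMap.det_toContinuousLinearMap, det_linear_mul_left]
    simp only [Matrix.det_mul, abs_mul, abs_pow, mul_pow, mul_inv]
    have : |k.det| ^ n ≠ 0 := by positivity
    field_simp

lemma cv_transpose {n : ℕ} (hn : 1 ≤ n) (f : Matrix (Fin n) (Fin n) ℝ → ℂ) :
    (∫ g, f g.transpose ∂(haarGL n) = ∫ g, f g ∂(haarGL n)) := by
  refine (change_var hn (fun g => g.transpose)
    (fun _ => LinearMap.toContinuousLinearMap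
      (Matrix.transposeLinearEquiv (Fin n) (Fin n) ℝ ℝ).toLinearMap) ?_ ?_ ?_ ?_ f).1
  · intro g _
    exact (LinearMap.toContinuousLinearMap
      (Matrix.transposeLinearEquiv (Fin n) (Fin n) ℝ ℝ).toLinearMap).hasFDerivAt
  · intro a _ b _ hab
    exact Matrix.transpose_injective hab
  · refine image_of_inverse _ (fun g => g.transpose) ?_ ?_ ?_
    · intro g hg; simpa using hg
    · intro g hg; simpa using hg
    · intro g _; simp
  · intro g hg
    rw [LinearMap.det_toContinuousLinearMap, det_transposeL]
    simp

lemma hasFDerivAt_matInv {n : ℕ} (g : Matrix (Fin n) (Fin n) ℝ) (hg : g.det ≠ 0) :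
    HasFDerivAt (fun g : Matrix (Fin n) (Fin n) ℝ => g⁻¹) (LinearMap.toContinuousLinearMap
      (-(LinearMap.mulLeft ℝ g⁻¹ ∘ₗ LinearMap.mulRight ℝ g⁻¹))) g := by
  set L := LinearMap.toContinuousLinearMap
      (-(LinearMap.mulLeft ℝ g⁻¹ ∘ₗ LinearMap.mulRight ℝ g⁻¹)) with hL
  have hLX : ∀ X, L X = -(g⁻¹ * (X * g⁻¹)) := fun X => rfl
  clear_value L
  obtain ⟨u, rfl⟩ := (Matrix.isUnit_iff_isUnit_det g).mpr (isUnit_iff_ne_zero.mpr hg)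
  letI i1 : NormedRing (Matrix (Fin n) (Fin n) ℝ) := Matrix.linftyOpNormedRing
  letI i2 : NormedAlgebra ℝ (Matrix (Fin n) (Fin n) ℝ) := Matrix.linftyOpNormedAlgebra
  have h := hasFDerivAt_ringInverse (𝕜 := ℝ) u
  have he : (Ring.inverse : Matrix (Fin n) (Fin n) ℝ → _) = fun g => g⁻¹ := by
    ext1 g; rw [Matrix.nonsing_inv_eq_ringInverse]
  rw [he] at h
  refine h.congr_fderiv ?_
  refine ContinuousLinearMap.ext fun X => ?_
  refine Eq.trans ?_ (hLX X).symm
  change -(((u⁻¹ : (Matrix (Fin n) (Fin n) ℝ)ˣ) : Matrix (Fin n) (Fin n) ℝ) * X *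
    ((u⁻¹ : (Matrix (Fin n) (Fin n) ℝ)ˣ) : Matrix (Fin n) (Fin n) ℝ)) = _
  rw [Matrix.coe_units_inv, Matrix.mul_assoc]

lemma cv_inv {n : ℕ} (hn : 1 ≤ n) (f : Matrix (Fin n) (Fin n) ℝ → ℂ) :
    (∫ g, f g⁻¹ ∂(haarGL n) = ∫ g, f g ∂(haarGL n)) := by
  refine (change_var hn (fun g => g⁻¹)
    (fun g => LinearMap.toContinuousLinearMap
      (-(LinearMap.mulLeft ℝ g⁻¹ ∘ₗ LinearMap.mulRight ℝ g⁻¹))) ?_ ?_ ?_ ?_ f).1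
  · intro g hg
    exact hasFDerivAt_matInv g hg
  · intro a ha b hb hab
    have := congrArg (·⁻¹) hab
    simpa [Matrix.nonsing_inv_nonsing_inv _ (isUnit_iff_ne_zero.mpr ha),
      Matrix.nonsing_inv_nonsing_inv _ (isUnit_iff_ne_zero.mpr hb)] using this
  · refine image_of_inverse _ (fun g => g⁻¹) ?_ ?_ ?_
    · intro g hg; simpa using hg
    · intro g hg; simpa using hg
    · intro g hg; exact Matrix.nonsing_inv_nonsing_inv _ (isUnit_iff_ne_zero.mpr hg)
  · intro g hg
    have hdet : |LinearMap.det (-(LinearMap.mulLeft ℝ g⁻¹ ∘ₗ LinearMap.mulRight ℝ g⁻¹))|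
        = |g⁻¹.det ^ n * g⁻¹.det ^ n| := by
      rw [← neg_one_smul ℝ, LinearMap.det_smul, LinearMap.det_comp, det_linear_mul_left,
        det_linear_mul_right, abs_mul, abs_pow, abs_neg, abs_one, one_pow, one_mul]
    rw [LinearMap.det_toContinuousLinearMap, hdet]
    simp only [Matrix.det_nonsing_inv, Ring.inverse_eq_inv', abs_mul, abs_pow, abs_inv, inv_pow]
    have : |g.det| ^ n ≠ 0 := by positivity
    field_simp

lemma ae_det_ne_zero {n : ℕ} (hn : 1 ≤ n) : ∀ᵐ g ∂(haarGL n), g.det ≠ 0 := by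
  refine (ae_withDensity_iff (measurable_dens n).coe_nnreal_ennreal).mpr ?_
  refine Filter.Eventually.of_forall fun g hg h0 => hg ?_
  rw [h0, abs_zero, zero_pow (by omega), inv_zero, Real.toNNReal_zero, ENNReal.coe_zero]

end ChangeVar

section Main

lemma orth_inv {n : ℕ} {k : Matrix (Fin n) (Fin n) ℝ} (hk : k ∈ Matrix.orthogonalGroup (Fin n) ℝ) :
    IsUnit k.det ∧ k⁻¹ = k.transpose ∧ k.transpose ∈ Matrix.orthogonalGroup (Fin n) ℝ := by
  have h1 : k.transpose * k = 1 := by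
    rw [Matrix.mem_orthogonalGroup_iff'] at hk
    exact hk
  have h2 : k⁻¹ = k.transpose := Matrix.inv_eq_left_inv h1
  refine ⟨?_, h2, ?_⟩
  · have := congrArg Matrix.det h1
    rw [Matrix.det_mul, Matrix.det_one] at this
    exact IsUnit.of_mul_eq_one_right _ this
  · rw [Matrix.mem_orthogonalGroup_iff]
    change k.transpose * k.transpose.transpose = 1
    rw [Matrix.transpose_transpose, h1]

lemma conv_formula
    (n : ℕ) (hn : 1 ≤ n)
    (F G : Matrix (Fin n) (Fin n) ℝ → ℂ)
    (hFinv : ∀ k₁ k₂ : Matrix (Fin n) (Fin n) ℝ, k₁ ∈ Matrix.orthogonalGroup (Fin n) ℝ →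
      k₂ ∈ Matrix.orthogonalGroup (Fin n) ℝ → ∀ g, F (k₁ * g * k₂) = F g)
    (hGinv : ∀ k₁ k₂ : Matrix (Fin n) (Fin n) ℝ, k₁ ∈ Matrix.orthogonalGroup (Fin n) ℝ →
      k₂ ∈ Matrix.orthogonalGroup (Fin n) ℝ → ∀ g, G (k₁ * g * k₂) = G g)
    (S₁ S₂ : Finset (Fin n)) (h : Matrix (Fin n) (Fin n) ℝ)
    (hint₁ : Integrable (fun g => (principalMinor g S₁ : ℂ) * F g
        * (principalMinor (g⁻¹ * h) S₂ : ℂ) * G (g⁻¹ * h)) (haarGL n)) :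
    ∫ g, (principalMinor g S₁ : ℂ) * F g
        * (principalMinor (g⁻¹ * h) S₂ : ℂ) * G (g⁻¹ * h) ∂(haarGL n)
      = ((if S₁ = S₂ then 1 else 0) / (n.choose S₁.card : ℂ)) * (principalMinor h S₁ : ℂ)
          * ∫ g, F g * G (g⁻¹ * h) ∂(haarGL n) := by
  set Φ : Matrix (Fin n) (Fin n) ℝ → ℂ := fun g => (principalMinor g S₁ : ℂ) * F g
        * (principalMinor (g⁻¹ * h) S₂ : ℂ) * G (g⁻¹ * h) with hΦ
  have h1 := fun p : Equiv.Perm (Fin n) × (Fin n → ℤˣ) =>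
    cv_right hn (signedPerm p.1 p.2) (orth_inv (signedPerm_mem p.1 p.2)).1 Φ
  have hsum : ∫ g, ∑ p : Equiv.Perm (Fin n) × (Fin n → ℤˣ), Φ (g * signedPerm p.1 p.2) ∂(haarGL n)
      = (n.factorial * 2 ^ n : ℂ) * ∫ g, Φ g ∂(haarGL n) := by
    rw [integral_finsetSum _ fun p _ => (h1 p).2 hint₁, Finset.sum_congr rfl fun p _ => (h1 p).1]
    simp [Fintype.card_perm]
  have hc : (n.choose S₁.card : ℂ) ≠ 0 := by
    have : S₁.card ≤ n := by simpa using S₁.card_le_univ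
    exact_mod_cast (Nat.choose_pos this).ne'
  have hone : (1 : Matrix (Fin n) (Fin n) ℝ) ∈ Matrix.orthogonalGroup (Fin n) ℝ := one_mem _
  have hpt : ∀ᵐ g ∂(haarGL n),
      ∑ p : Equiv.Perm (Fin n) × (Fin n → ℤˣ), Φ (g * signedPerm p.1 p.2)
      = (n.factorial * 2 ^ n : ℂ) * (((if S₁ = S₂ then 1 else 0) / (n.choose S₁.card : ℂ)) *
        (principalMinor h S₁ : ℂ)) * (F g * G (g⁻¹ * h)) := by
    filter_upwards [ae_det_ne_zero hn] with g hg
    have hterm : ∀ p : Equiv.Perm (Fin n) × (Fin n → ℤˣ), Φ (g * signedPerm p.1 p.2) =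
        ((principalMinor (g * signedPerm p.1 p.2) S₁ *
          principalMinor ((signedPerm p.1 p.2).transpose * (g⁻¹ * h)) S₂ : ℝ) : ℂ)
          * (F g * G (g⁻¹ * h)) := by
      intro p
      obtain ⟨_, hki, hkt⟩ := orth_inv (signedPerm_mem p.1 p.2)
      have e1 : F (g * signedPerm p.1 p.2) = F g := by
        have := hFinv 1 _ hone (signedPerm_mem p.1 p.2) g
        rwa [Matrix.one_mul] at this
      have e2 : G ((signedPerm p.1 p.2).transpose * (g⁻¹ * h)) = G (g⁻¹ * h) := by
        have := hGinv _ 1 hkt hone (g⁻¹ * h)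
        rwa [Matrix.mul_one] at this
      simp only [hΦ]
      rw [Matrix.mul_inv_rev, hki, Matrix.mul_assoc, e1, e2]
      push_cast
      ring
    rw [Finset.sum_congr rfl fun p _ => hterm p, ← Finset.sum_mul, ← Complex.ofReal_sum]
    congr 1
    have := congrArg (fun r : ℝ => (r : ℂ)) (average_minors g (g⁻¹ * h) S₁ S₂)
    rw [Matrix.mul_nonsing_inv_cancel_left _ _ (isUnit_iff_ne_zero.mpr hg)] at this
    apply mul_left_cancel₀ hc
    rw [Complex.ofReal_mul, Complex.ofReal_natCast] at this
    rw [this]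
    field_simp
    split_ifs <;> push_cast <;> ring
  rw [integral_congr_ae hpt, integral_const_mul, mul_assoc] at hsum
  have hne : (n.factorial * 2 ^ n : ℂ) ≠ 0 := by
    have : (n.factorial : ℂ) ≠ 0 := by exact_mod_cast n.factorial_ne_zero
    simp [this]
  exact (mul_left_cancel₀ hne hsum).symm

lemma conv_comm
    (n : ℕ) (hn : 1 ≤ n)
    (F G : Matrix (Fin n) (Fin n) ℝ → ℂ)
    (hFinv : ∀ k₁ k₂ : Matrix (Fin n) (Fin n) ℝ, k₁ ∈ Matrix.orthogonalGroup (Fin n) ℝ →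
      k₂ ∈ Matrix.orthogonalGroup (Fin n) ℝ → ∀ g, F (k₁ * g * k₂) = F g)
    (hGinv : ∀ k₁ k₂ : Matrix (Fin n) (Fin n) ℝ, k₁ ∈ Matrix.orthogonalGroup (Fin n) ℝ →
      k₂ ∈ Matrix.orthogonalGroup (Fin n) ℝ → ∀ g, G (k₁ * g * k₂) = G g)
    (h : Matrix (Fin n) (Fin n) ℝ) (hh : IsUnit h.det) :
    ∫ g, F g * G (g⁻¹ * h) ∂(haarGL n) = ∫ g, G g * F (g⁻¹ * h) ∂(haarGL n) := by
  have hone : (1 : Matrix (Fin n) (Fin n) ℝ) ∈ Matrix.orthogonalGroup (Fin n) ℝ := one_mem _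
  have hsymm : ∀ F : Matrix (Fin n) (Fin n) ℝ → ℂ,
      (∀ k₁ k₂ : Matrix (Fin n) (Fin n) ℝ, k₁ ∈ Matrix.orthogonalGroup (Fin n) ℝ →
        k₂ ∈ Matrix.orthogonalGroup (Fin n) ℝ → ∀ g, F (k₁ * g * k₂) = F g) →
      ∀ g, g.det ≠ 0 → F g.transpose = F g := by
    intro F hF g hg
    obtain ⟨u, hu, hgu⟩ := exists_orthogonal_transpose g (isUnit_iff_ne_zero.mpr hg)
    rw [hgu, hF u u hu hu]
  obtain ⟨u, hu, hhu⟩ := exists_orthogonal_transpose h hh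
  obtain ⟨hud, hui, hut⟩ := orth_inv hu
  -- substitute `g = h x⁻¹` on the right
  have s1 : ∫ g, G g * F (g⁻¹ * h) ∂(haarGL n)
      = ∫ g, G (h * g⁻¹) * F ((h * g⁻¹)⁻¹ * h) ∂(haarGL n) := by
    rw [← (cv_left hn h hh (fun g => G g * F (g⁻¹ * h))).1,
      ← cv_inv hn (fun g => G (h * g) * F ((h * g)⁻¹ * h))]
  have s2 : ∫ g, G (h * g⁻¹) * F ((h * g⁻¹)⁻¹ * h) ∂(haarGL n)
      = ∫ g, F g * G (g⁻¹.transpose * h.transpose) ∂(haarGL n) := by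
    refine integral_congr_ae ?_
    filter_upwards [ae_det_ne_zero hn] with g hg
    have hgu := isUnit_iff_ne_zero.mpr hg
    have e1 : (h * g⁻¹)⁻¹ * h = g := by
      rw [Matrix.mul_inv_rev, Matrix.nonsing_inv_nonsing_inv _ hgu,
        Matrix.nonsing_inv_mul_cancel_right _ _ hh]
    have e2 : G (g⁻¹.transpose * h.transpose) = G (h * g⁻¹) := by
      rw [← Matrix.transpose_mul]
      apply hsymm G hGinv
      simp [hg, hh.ne_zero]
    simp only [e1, e2, mul_comm]
  have s3 : ∫ g, F g * G (g⁻¹.transpose * h.transpose) ∂(haarGL n)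
      = ∫ g, F g * G (g⁻¹ * u * h) ∂(haarGL n) := by
    rw [← cv_transpose hn (fun g => F g * G (g⁻¹.transpose * h.transpose))]
    refine integral_congr_ae ?_
    filter_upwards [ae_det_ne_zero hn] with g hg
    have e1 := hsymm F hFinv g hg
    have e2 : G (g⁻¹ * h.transpose) = G (g⁻¹ * u * h) := by
      have := hGinv 1 u hone hu (g⁻¹ * u * h)
      rw [← this, hhu]
      simp only [Matrix.mul_assoc, Matrix.one_mul]
    simp only [e1, Matrix.transpose_nonsing_inv, Matrix.transpose_transpose, e2]
  rw [s1, s2, s3, ← (cv_left hn u hud (fun g => F g * G (g⁻¹ * u * h))).1]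
  refine integral_congr_ae (Filter.Eventually.of_forall fun g => ?_)
  have e1 : F (u * g) = F g := by
    have := hFinv u 1 hu hone g
    rwa [Matrix.mul_one] at this
  simp only [e1, Matrix.mul_inv_rev, Matrix.nonsing_inv_mul_cancel_right _ _ hud]

end Main

/-- for continuous `O(n)`-bi-invariant `F, G` on `GL_n(ℝ)` with absolutely
convergent integrals and subsets `S₁, S₂ ⊆ {1,…,n}`,
`∫ Δ_{S₁}(g) F(g) Δ_{S₂}(g⁻¹h) G(g⁻¹h) dμ(g)
  = ([S₁ = S₂]/binom(n,|S₁|)) Δ_{S₁}(h) ∫ F(g) G(g⁻¹h) dμ(g)`;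
in particular the functions `g ↦ Δ_S(g)F(g)` span a commutative convolution algebra:
the two convolutions `(Δ_{S₁}F) * (Δ_{S₂}G)` and `(Δ_{S₂}G) * (Δ_{S₁}F)` agree. -/
theorem convolution_principalMinor_biinvariant
    (n : ℕ) (hn : 1 ≤ n)
    (F G : Matrix (Fin n) (Fin n) ℝ → ℂ)
    (hFcont : ContinuousOn F {g | IsUnit g.det})
    (hGcont : ContinuousOn G {g | IsUnit g.det})
    (hFinv : ∀ k₁ k₂ : Matrix (Fin n) (Fin n) ℝ, k₁ ∈ Matrix.orthogonalGroup (Fin n) ℝ →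
      k₂ ∈ Matrix.orthogonalGroup (Fin n) ℝ → ∀ g, F (k₁ * g * k₂) = F g)
    (hGinv : ∀ k₁ k₂ : Matrix (Fin n) (Fin n) ℝ, k₁ ∈ Matrix.orthogonalGroup (Fin n) ℝ →
      k₂ ∈ Matrix.orthogonalGroup (Fin n) ℝ → ∀ g, G (k₁ * g * k₂) = G g)
    (S₁ S₂ : Finset (Fin n))
    (hint₁ : ∀ h : Matrix (Fin n) (Fin n) ℝ, IsUnit h.det →
      Integrable (fun g => (principalMinor g S₁ : ℂ) * F g
        * (principalMinor (g⁻¹ * h) S₂ : ℂ) * G (g⁻¹ * h)) (haarGL n))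
    (hint₁' : ∀ h : Matrix (Fin n) (Fin n) ℝ, IsUnit h.det →
      Integrable (fun g => (principalMinor g S₂ : ℂ) * G g
        * (principalMinor (g⁻¹ * h) S₁ : ℂ) * F (g⁻¹ * h)) (haarGL n))
    (hint₂ : ∀ h : Matrix (Fin n) (Fin n) ℝ, IsUnit h.det →
      Integrable (fun g => F g * G (g⁻¹ * h)) (haarGL n))
    (h : Matrix (Fin n) (Fin n) ℝ) (hh : IsUnit h.det) :
    (∫ g, (principalMinor g S₁ : ℂ) * F g
        * (principalMinor (g⁻¹ * h) S₂ : ℂ) * G (g⁻¹ * h) ∂(haarGL n)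
      = ((if S₁ = S₂ then 1 else 0) / (n.choose S₁.card : ℂ)) * (principalMinor h S₁ : ℂ)
          * ∫ g, F g * G (g⁻¹ * h) ∂(haarGL n))
    ∧ (∫ g, (principalMinor g S₁ : ℂ) * F g
        * (principalMinor (g⁻¹ * h) S₂ : ℂ) * G (g⁻¹ * h) ∂(haarGL n)
      = ∫ g, (principalMinor g S₂ : ℂ) * G g
          * (principalMinor (g⁻¹ * h) S₁ : ℂ) * F (g⁻¹ * h) ∂(haarGL n)) := by
  have e1 := conv_formula n hn F G hFinv hGinv S₁ S₂ h (hint₁ h hh)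
  have e2 := conv_formula n hn G F hGinv hFinv S₂ S₁ h (hint₁' h hh)
  refine ⟨e1, ?_⟩
  rw [e1, e2, conv_comm n hn F G hFinv hGinv h hh]
  by_cases hS : S₁ = S₂
  · subst hS; rfl
  · simp [hS, Ne.symm hS]
end

section
/- For every n ≥ 1 and every subset S ⊆ {1,…,n}, the square of the principal minor integrates over the orthogonal group to the reciprocal binomial coefficient: ∫_{O(n)} Δ_S(k)² dk = 1 / binom(n,|S|), where dk is the Haar probability measure on O(n). (This is the value at the identity of the generalized spherical function: Φ_{ε,γ}(1) = 1/dim(⋀^{|ε|}ℂ^n).) -/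
open MeasureTheory

/-- Averaged Cauchy–Binet identity. -/
lemma sum_det_sq {n : ℕ} {ι : Type*} [Fintype ι] [DecidableEq ι]
    (A : Matrix (Fin n) ι ℝ) :
    ∑ f : ι → Fin n, (Matrix.det (Matrix.of fun i j : ι => A (f i) j)) ^ 2
      = (Fintype.card ι).factorial * Matrix.det (A.transpose * A) := by
  classical
  have h1 : Matrix.det (A.transpose * A) =
      ∑ f : ι → Fin n, Matrix.det (Matrix.of fun i j : ι => A (f i) j) * ∏ i, A (f i) i := by
    simp only [Matrix.det_apply', Matrix.mul_apply, Matrix.transpose_apply, Matrix.of_apply]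
    simp_rw [Finset.prod_univ_sum, Fintype.piFinset_univ, Finset.sum_mul, Finset.mul_sum]
    rw [Finset.sum_comm]
    refine Finset.sum_congr rfl fun f _ => ?_
    refine (Equiv.sum_comp (Equiv.inv (Equiv.Perm ι)) _).symm.trans ?_
    refine Finset.sum_congr rfl fun σ _ => ?_
    rw [Finset.prod_mul_distrib, mul_assoc]
    simp only [Equiv.inv_apply, Equiv.Perm.sign_inv]
    congr 2
    rw [← Equiv.prod_comp σ]
    simp
  have h2 : ∀ σ : Equiv.Perm ι,
      ∑ f : ι → Fin n, Matrix.det (Matrix.of fun i j : ι => A (f i) j) *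
        ((Equiv.Perm.sign σ : ℤ) * ∏ i, A (f (σ i)) i) = Matrix.det (A.transpose * A) := by
    intro σ
    rw [h1]
    symm
    rw [← Equiv.sum_comp (Equiv.arrowCongr σ.symm (Equiv.refl (Fin n)))]
    refine Finset.sum_congr rfl fun f _ => ?_
    have := Matrix.det_permute σ (Matrix.of fun i j : ι => A (f i) j)
    have h3 : (Matrix.of fun i j : ι => A ((Equiv.arrowCongr σ.symm (Equiv.refl (Fin n))) f i) j)
      = (Matrix.of fun i j : ι => A (f i) j).submatrix σ id := by
      ext i j; simp [Equiv.arrowCongr]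
    rw [h3, this]
    simp [Equiv.arrowCongr]
    ring
  calc _ = ∑ f : ι → Fin n, ∑ σ : Equiv.Perm ι,
      Matrix.det (Matrix.of fun i j : ι => A (f i) j) *
        ((Equiv.Perm.sign σ : ℤ) * ∏ i, A (f (σ i)) i) := by
        refine Finset.sum_congr rfl fun f _ => ?_
        rw [← Finset.mul_sum, sq]
        congr 1
        rw [Matrix.det_apply']
        rfl
    _ = _ := by
        rw [Finset.sum_comm, Finset.sum_congr rfl fun σ _ => h2 σ]
        simp [Fintype.card_perm]

lemma perm_mem {n : ℕ} (σ : Equiv.Perm (Fin n)) :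
    σ.permMatrix ℝ ∈ Matrix.orthogonalGroup (Fin n) ℝ := by
  rw [Matrix.mem_orthogonalGroup_iff,
    Matrix.transpose_permMatrix, ← Matrix.permMatrix_mul]
  simp

/-- For every `n ≥ 1` and every subset `S ⊆ {1,…,n}`, the square of the
principal minor integrates over `O(n)` (with Haar probability measure) to the
reciprocal binomial coefficient: `∫_{O(n)} Δ_S(k)² dk = 1 / binom(n,|S|)`. -/
theorem integral_principalMinor_sq
    (n : ℕ) (hn : 1 ≤ n)
    [MeasurableSpace (Matrix.orthogonalGroup (Fin n) ℝ)]
    [BorelSpace (Matrix.orthogonalGroup (Fin n) ℝ)]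
    (μ : Measure (Matrix.orthogonalGroup (Fin n) ℝ))
    [μ.IsHaarMeasure] [IsProbabilityMeasure μ]
    (S : Finset (Fin n)) :
    ∫ k, (principalMinor (k : Matrix (Fin n) (Fin n) ℝ) S) ^ 2 ∂μ
      = 1 / (n.choose S.card : ℝ) := by
  classical
  set D : (S → Fin n) → Matrix.orthogonalGroup (Fin n) ℝ → ℝ := fun f k =>
    (Matrix.det (Matrix.of fun i j : S => (k : Matrix (Fin n) (Fin n) ℝ) (f i) j)) ^ 2 with hD
  have hsum : ∀ k, ∑ f, D f k = S.card.factorial := by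
    intro k
    have h := sum_det_sq (Matrix.of fun (i : Fin n) (j : S) => (k : Matrix (Fin n) (Fin n) ℝ) i j)
    have h1 : (Matrix.of fun (i : Fin n) (j : S) =>
        (k : Matrix (Fin n) (Fin n) ℝ) i j).transpose * (Matrix.of fun (i : Fin n) (j : S) =>
        (k : Matrix (Fin n) (Fin n) ℝ) i j) = 1 := by
      have hk := (Matrix.mem_orthogonalGroup_iff' (Fin n) ℝ).1 k.2
      ext i j
      have := congrFun (congrFun hk i) j
      simp only [Matrix.mul_apply, Matrix.one_apply, Matrix.transpose_apply,
        Matrix.of_apply] at this ⊢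
      rw [this]
      simp only [Subtype.ext_iff]
    rw [h1] at h
    simpa using h
  have hIntegrable : ∀ f, Integrable (D f) μ := by
    intro f
    refine Integrable.of_bound (C := (S.card.factorial : ℝ)) ?_ ?_
    · apply Continuous.aestronglyMeasurable
      refine Continuous.pow (Continuous.matrix_det ?_) 2
      refine continuous_matrix fun i j => ?_
      exact (continuous_subtype_val.matrix_elem _ _)
    · refine Filter.Eventually.of_forall fun k => ?_
      rw [← hsum k, Real.norm_of_nonneg (sq_nonneg _)]
      exact Finset.single_le_sum (f := fun f => D f k) (fun f _ => sq_nonneg _) (Finset.mem_univ f)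
  have hinj : ∀ f : S → Fin n, Function.Injective f →
      ∫ k, D f k ∂μ = ∫ k, (principalMinor (k : Matrix (Fin n) (Fin n) ℝ) S) ^ 2 ∂μ := by
    intro f hf
    let e : {x // x ∈ S} ≃ {x // x ∈ Set.range f} := Equiv.ofInjective f hf
    let σ : Equiv.Perm (Fin n) := e.extendSubtype
    have hσ : ∀ i : S, σ i = f i := fun i => by
      have := e.extendSubtype_apply_of_mem i i.2
      simpa [e] using this
    rw [← integral_mul_left_eq_self (μ := μ)
      (fun k => (principalMinor (k : Matrix (Fin n) (Fin n) ℝ) S) ^ 2) ⟨_, perm_mem σ⟩]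
    congr 1
    ext k
    simp only [hD, principalMinor]
    congr 3
    ext i j
    simp [Equiv.Perm.permMatrix, PEquiv.toMatrix_toPEquiv_mul, hσ]
  have hninj : ∀ f : S → Fin n, ¬ Function.Injective f → ∫ k, D f k ∂μ = 0 := by
    intro f hf
    simp only [Function.Injective, not_forall] at hf
    obtain ⟨a, b, hab, hne⟩ := hf
    have : D f = 0 := by
      ext k
      simp only [hD]
      rw [Matrix.det_zero_of_row_eq hne]
      · simp
      · ext j; simp [hab]
    simp [this]
  set c := ∫ k, (principalMinor (k : Matrix (Fin n) (Fin n) ℝ) S) ^ 2 ∂μ with hc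
  have key : (n.descFactorial S.card : ℝ) * c = S.card.factorial := by
    have h1 : ∫ k, ∑ f, D f k ∂μ = S.card.factorial := by
      simp [hsum]
    rw [integral_finsetSum _ fun f _ => hIntegrable f] at h1
    rw [← h1]
    have h2 : ∀ f : S → Fin n, ∫ k, D f k ∂μ = if Function.Injective f then c else 0 := by
      intro f
      split_ifs with h
      · exact hinj f h
      · exact hninj f h
    simp_rw [h2]
    rw [← Finset.sum_filter, Finset.sum_const, nsmul_eq_mul]
    congr 2
    rw [← Fintype.card_subtype,
      Fintype.card_congr (Equiv.subtypeInjectiveEquivEmbedding S (Fin n)),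
      Fintype.card_embedding_eq]
    simp
  have hle : S.card ≤ n := by simpa using S.card_le_univ
  rw [Nat.descFactorial_eq_factorial_mul_choose] at key
  have h1 : (S.card.factorial : ℝ) ≠ 0 := by exact_mod_cast S.card.factorial_ne_zero
  have h2 : (n.choose S.card : ℝ) ≠ 0 := by exact_mod_cast (Nat.choose_pos hle).ne'
  push_cast at key
  rw [eq_div_iff h2]
  apply mul_left_cancel₀ h1
  linarith
end
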